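/- Let ε, μ ∈ ℝ, f ∈ ℂ, and let Δ be a 2×2 complex matrix satisfying the C₂zT constraint conj(Δ) = σx · Δ · σx. Let h = (ε−μ)·1 + (Re f)·σx + (Im f)·σy and H = fromBlocks h Δ Δᴴ (−hᵀ). Then H possesses the effective spinless C₂zT symmetry U · conj(H) · U = H, where U is the 4×4 block-diagonal matrix fromBlocks σx 0 0 σx. -/

import Mathlib

open Matrix Complex Polynomial

noncomputable section

/-- Pauli matrix σx. -/
def σx : Matrix (Fin 2) (Fin 2) ℂ := !![0, 1; 1, 0]

/-- Pauli matrix σy. -/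
def σy : Matrix (Fin 2) (Fin 2) ℂ := !![0, -Complex.I; Complex.I, 0]

/-- Normal-state block h = (ε−μ)·1 + (Re f)·σx + (Im f)·σy. -/
def hBlock (ε μ : ℝ) (f : ℂ) : Matrix (Fin 2) (Fin 2) ℂ :=
  ((ε - μ : ℝ) : ℂ) • (1 : Matrix (Fin 2) (Fin 2) ℂ) + (f.re : ℂ) • σx + (f.im : ℂ) • σy

/-- Euler-obstructed pairing block Δ∥ = !![conj d∥, 0; 0, d∥]. -/
def DeltaPar (dp : ℂ) : Matrix (Fin 2) (Fin 2) ℂ := !![(starRingEnd ℂ) dp, 0; 0, dp]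

/-- Trivial pairing block Δ⊥ = !![0, d⊥; conj d⊥, 0]. -/
def DeltaPerp (dt : ℂ) : Matrix (Fin 2) (Fin 2) ℂ := !![0, dt; (starRingEnd ℂ) dt, 0]

/-- Bogoliubov–de Gennes matrix H = fromBlocks h Δ Δᴴ (−hᵀ), Δ = Δ∥ + Δ⊥. -/
def BdG (ε μ : ℝ) (f dp dt : ℂ) : Matrix (Fin 2 ⊕ Fin 2) (Fin 2 ⊕ Fin 2) ℂ :=
  Matrix.fromBlocks (hBlock ε μ f) (DeltaPar dp + DeltaPerp dt)
    (DeltaPar dp + DeltaPerp dt)ᴴ (-(hBlock ε μ f)ᵀ)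

/-- BdG matrix with vanishing trivial gap (d⊥ = 0). -/
def BdG0 (ε μ : ℝ) (f dp : ℂ) : Matrix (Fin 2 ⊕ Fin 2) (Fin 2 ⊕ Fin 2) ℂ :=
  BdG ε μ f dp 0

theorem σx_mul_self : σx * σx = 1 := by
  ext i j
  fin_cases i <;> fin_cases j <;> simp [σx]

theorem transpose_σx : σxᵀ = σx := by
  ext i j
  fin_cases i <;> fin_cases j <;> simp [σx]

theorem conjTranspose_σx : σxᴴ = σx := by
  ext i j
  fin_cases i <;> fin_cases j <;> simp [σx]

/-- Conjugation by `σx` is an involution. -/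
theorem σx_conj_conj (A : Matrix (Fin 2) (Fin 2) ℂ) : σx * (σx * A * σx) * σx = A := by
  rw [Matrix.mul_assoc σx A σx, ← Matrix.mul_assoc, σx_mul_self, Matrix.one_mul,
    Matrix.mul_assoc, σx_mul_self, Matrix.mul_one]

/-- The normal-state block is C₂zT-symmetric. -/
theorem hBlock_map_conj (ε μ : ℝ) (f : ℂ) :
    (hBlock ε μ f).map (starRingEnd ℂ) = σx * hBlock ε μ f * σx := by
  ext i j
  fin_cases i <;> fin_cases j <;>
    simp [hBlock, σx, σy, Matrix.mul_apply, Matrix.vecMul, dotProduct, Fin.sum_univ_two,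
      Complex.ext_iff]

theorem conjTranspose_map_conj {A : Matrix (Fin 2) (Fin 2) ℂ}
    (hA : A.map (starRingEnd ℂ) = σx * A * σx) :
    Aᴴ.map (starRingEnd ℂ) = σx * Aᴴ * σx := by
  calc Aᴴ.map (starRingEnd ℂ) = (A.map (starRingEnd ℂ))ᴴ := rfl
    _ = σx * Aᴴ * σx := by
      rw [hA, conjTranspose_mul, conjTranspose_mul, conjTranspose_σx, Matrix.mul_assoc]

theorem neg_transpose_map_conj {A : Matrix (Fin 2) (Fin 2) ℂ}
    (hA : A.map (starRingEnd ℂ) = σx * A * σx) :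
    (-Aᵀ).map (starRingEnd ℂ) = σx * (-Aᵀ) * σx := by
  calc (-Aᵀ).map (starRingEnd ℂ) = -(A.map (starRingEnd ℂ))ᵀ := by ext; simp
    _ = σx * (-Aᵀ) * σx := by
      rw [hA, transpose_mul, transpose_mul, transpose_σx, ← Matrix.mul_assoc,
        Matrix.mul_neg, Matrix.neg_mul]

/-- for a C₂zT-invariant pairing (conj Δ = σx·Δ·σx), the BdG matrix
satisfies the effective spinless C₂zT symmetry U·conj(H)·U = H with
U = fromBlocks σx 0 0 σx. -/
theorem stmt5 (ε μ : ℝ) (f : ℂ) (Δ : Matrix (Fin 2) (Fin 2) ℂ)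
    (hC2T : Δ.map (starRingEnd ℂ) = σx * Δ * σx) :
    (Matrix.fromBlocks σx 0 0 σx) *
        ((Matrix.fromBlocks (hBlock ε μ f) Δ Δᴴ (-(hBlock ε μ f)ᵀ)).map (starRingEnd ℂ)) *
        (Matrix.fromBlocks σx 0 0 σx)
      = Matrix.fromBlocks (hBlock ε μ f) Δ Δᴴ (-(hBlock ε μ f)ᵀ) := by
  rw [fromBlocks_map, hBlock_map_conj, hC2T, conjTranspose_map_conj hC2T,
    neg_transpose_map_conj (hBlock_map_conj ε μ f)]
  simp only [fromBlocks_multiply, Matrix.zero_mul, Matrix.mul_zero, add_zero, zero_add,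
    σx_conj_conj]
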